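/- arXiv:1003.4015 — 5 statements merged into one kernel-verified Lean document; each statement's English description precedes it below -/
import Mathlib

section
/- The simple continued fraction whose partial quotients are the consecutive odd numbers satisfies [0; 1, 3, 5, 7, 9, …] = (e − e^{−1})/(e + e^{−1}) = tanh(1); that is, the convergents P_n/Q_n of this continued fraction converge to tanh(1) as n → ∞. -/
open Filter Topology

/-- Numerators of the convergents of the simple continued fraction `[0; a 1, a 2, …]`. -/
def cfP (a : ℕ → ℕ) : ℕ → ℕ
  | 0 => 0
  | 1 => 1
  | n + 2 => a (n + 2) * cfP a (n + 1) + cfP a n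

/-- Denominators of the convergents of the simple continued fraction `[0; a 1, a 2, …]`. -/
def cfQ (a : ℕ → ℕ) : ℕ → ℕ
  | 0 => 1
  | 1 => a 1
  | n + 2 => a (n + 2) * cfQ a (n + 1) + cfQ a n

noncomputable def auxJ (n : ℕ) : ℝ := ∫ x in (-1:ℝ)..1, (1 - x ^ 2) ^ n * Real.exp x

lemma auxJ_int (n : ℕ) : IntervalIntegrable (fun x : ℝ => (1 - x ^ 2) ^ n * Real.exp x)
    MeasureTheory.volume (-1) 1 := by
  apply Continuous.intervalIntegrable
  fun_prop

lemma auxJ_zero : auxJ 0 = Real.exp 1 - Real.exp (-1) := by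
  simp [auxJ]

lemma auxJ_one : auxJ 1 = 4 * Real.exp (-1) := by
  have h := intervalIntegral.integral_eq_sub_of_hasDerivAt (a := (-1:ℝ)) (b := 1)
    (f := fun x : ℝ => (-(x - 1) ^ 2) * Real.exp x)
    (f' := fun x : ℝ => (1 - x ^ 2) ^ 1 * Real.exp x) (fun x _ => by
      have h1 := ((((hasDerivAt_id x).sub_const 1).pow 2).neg).mul (Real.hasDerivAt_exp x)
      refine h1.congr_deriv ?_
      simp
      ring) (auxJ_int 1)
  unfold auxJ
  rw [h]
  norm_num

lemma auxJ_rec (n : ℕ) : auxJ (n + 2) =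
    4 * (n + 1) * (n + 2) * auxJ n - 2 * (n + 2) * (2 * n + 3) * auxJ (n + 1) := by
  have hc : ∀ m : ℕ, ∀ c : ℝ, IntervalIntegrable
      (fun x : ℝ => c * ((1 - x ^ 2) ^ m * Real.exp x)) MeasureTheory.volume (-1) 1 :=
    fun m c => (auxJ_int m).const_mul c
  have h := intervalIntegral.integral_eq_sub_of_hasDerivAt (a := (-1:ℝ)) (b := 1)
    (f := fun x : ℝ => ((1 - x ^ 2) ^ (n + 2) + 2 * (n + 2) * (x * (1 - x ^ 2) ^ (n + 1)))
      * Real.exp x)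
    (f' := fun x : ℝ => (1 - x ^ 2) ^ (n + 2) * Real.exp x
      + (2 * (n + 2) * (2 * n + 3)) * ((1 - x ^ 2) ^ (n + 1) * Real.exp x)
      - (4 * (n + 1) * (n + 2)) * ((1 - x ^ 2) ^ n * Real.exp x)) (fun x _ => by
      have hu : HasDerivAt (fun x : ℝ => 1 - x ^ 2) (-(2 * x)) x := by
        simpa using (hasDerivAt_pow 2 x).const_sub 1
      have h1 := ((hu.pow (n + 2)).add
        (((hasDerivAt_id x).mul (hu.pow (n + 1))).const_mul (2 * ((n:ℝ) + 2)))).mul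
        (Real.hasDerivAt_exp x)
      refine h1.congr_deriv ?_
      simp
      ring) (((auxJ_int _).add (hc _ _)).sub (hc _ _))
  rw [intervalIntegral.integral_sub ((auxJ_int _).add (hc _ _)) (hc _ _),
    intervalIntegral.integral_add (auxJ_int _) (hc _ _),
    intervalIntegral.integral_const_mul, intervalIntegral.integral_const_mul] at h
  change auxJ (n + 2) + _ * auxJ (n + 1) - _ * auxJ n = _ at h
  norm_num at h
  linarith

lemma auxJ_bound (n : ℕ) : |auxJ n| ≤ Real.exp 1 * 2 := by
  have h := intervalIntegral.norm_integral_le_of_norm_le_const (a := (-1:ℝ)) (b := 1)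
    (f := fun x : ℝ => (1 - x ^ 2) ^ n * Real.exp x) (C := Real.exp 1) (fun x hx => by
      rw [Set.uIoc_of_le (by norm_num)] at hx
      obtain ⟨h1, h2⟩ := hx
      have h3 : 0 ≤ 1 - x ^ 2 := by nlinarith
      have h4 : (1 - x ^ 2) ^ n ≤ 1 := pow_le_one₀ h3 (by nlinarith [sq_nonneg x])
      have h5 : 0 ≤ (1 - x ^ 2) ^ n := pow_nonneg h3 n
      rw [Real.norm_eq_abs, abs_of_nonneg (mul_nonneg h5 (Real.exp_pos x).le)]
      have h6 : Real.exp x ≤ Real.exp 1 := Real.exp_le_exp.2 h2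
      nlinarith [Real.exp_pos x])
  norm_num at h
  exact h

lemma aux_key (n : ℕ) :
    (Real.exp 1 + Real.exp (-1)) * (cfP (fun k => 2 * k - 1) n : ℝ)
      - (Real.exp 1 - Real.exp (-1)) * (cfQ (fun k => 2 * k - 1) n : ℝ)
      = (-1) ^ (n + 1) * (auxJ n / (2 ^ n * (n.factorial : ℝ))) := by
  induction n using Nat.twoStepInduction with
  | zero => simp [cfP, cfQ, auxJ_zero]
  | one => simp [cfP, cfQ, auxJ_one]; ring
  | more n ih1 ih2 =>
    have e : 2 * (n + 2) - 1 = 2 * n + 3 := by omega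
    simp only [cfP, cfQ, e]
    push_cast
    have : (Real.exp 1 + Real.exp (-1)) * ((2 * (n:ℝ) + 3) * (cfP (fun k => 2 * k - 1) (n + 1) : ℝ)
        + (cfP (fun k => 2 * k - 1) n : ℝ))
        - (Real.exp 1 - Real.exp (-1)) * ((2 * (n:ℝ) + 3) * (cfQ (fun k => 2 * k - 1) (n + 1) : ℝ)
        + (cfQ (fun k => 2 * k - 1) n : ℝ))
        = (2 * (n:ℝ) + 3) * ((-1) ^ (n + 1 + 1) * (auxJ (n + 1) / (2 ^ (n + 1) * ((n + 1).factorial : ℝ))))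
        + (-1) ^ (n + 1) * (auxJ n / (2 ^ n * (n.factorial : ℝ))) := by
      rw [← ih1, ← ih2]; ring
    rw [this, auxJ_rec, Nat.factorial_succ (n + 1), Nat.factorial_succ n]
    have hf : (n.factorial : ℝ) ≠ 0 := by positivity
    have h1 : (n : ℝ) + 1 ≠ 0 := by positivity
    have h2 : (n : ℝ) + 2 ≠ 0 := by positivity
    have h2' : (n : ℝ) + 1 + 1 ≠ 0 := by positivity
    push_cast
    field_simp
    ring

lemma aux_Q (n : ℕ) : n ≤ cfQ (fun k => 2 * k - 1) n ∧ 1 ≤ cfQ (fun k => 2 * k - 1) n := by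
  induction n using Nat.twoStepInduction with
  | zero => simp [cfQ]
  | one => simp [cfQ]
  | more n ih1 ih2 =>
    have e : 2 * (n + 2) - 1 = 2 * n + 3 := by omega
    simp only [cfQ, e]
    constructor <;> nlinarith [ih1.1, ih1.2, ih2.1, ih2.2]

/-- The continued fraction `[0; 1, 3, 5, 7, 9, …]` whose partial quotients are the odd
numbers equals `(e − e⁻¹)/(e + e⁻¹) = tanh 1`: its convergents converge to `tanh 1`. -/
theorem contfrac_odd_numbers_eq_tanh_one :
    Tendsto (fun n => (cfP (fun k => 2 * k - 1) n : ℝ) / (cfQ (fun k => 2 * k - 1) n : ℝ))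
      atTop (𝓝 ((Real.exp 1 - Real.exp (-1)) / (Real.exp 1 + Real.exp (-1)))) ∧
    (Real.exp 1 - Real.exp (-1)) / (Real.exp 1 + Real.exp (-1)) = Real.tanh 1 := by
  constructor
  · have hC : 0 < Real.exp 1 + Real.exp (-1) := by positivity
    rw [tendsto_iff_dist_tendsto_zero]
    have hlim := tendsto_const_div_atTop_nhds_zero_nat
      (Real.exp 1 * 2 / (Real.exp 1 + Real.exp (-1)))
    refine squeeze_zero' (Eventually.of_forall fun n => dist_nonneg) ?_ hlim
    filter_upwards [eventually_gt_atTop 0] with n hn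
    have hn' : (0:ℝ) < n := by exact_mod_cast hn
    have hQ : (n:ℝ) ≤ (cfQ (fun k => 2 * k - 1) n : ℝ) := by exact_mod_cast (aux_Q n).1
    have hQ0 : (0:ℝ) < (cfQ (fun k => 2 * k - 1) n : ℝ) := lt_of_lt_of_le hn' hQ
    have hk := aux_key n
    have hd : (1:ℝ) ≤ 2 ^ n * (n.factorial : ℝ) := by
      have : 1 ≤ 2 ^ n * n.factorial := Nat.mul_pos (by positivity) n.factorial_pos
      exact_mod_cast this
    have hb : |(Real.exp 1 + Real.exp (-1)) * (cfP (fun k => 2 * k - 1) n : ℝ)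
      - (Real.exp 1 - Real.exp (-1)) * (cfQ (fun k => 2 * k - 1) n : ℝ)| ≤ Real.exp 1 * 2 := by
      rw [hk, abs_mul, abs_pow, abs_neg, abs_one, one_pow, one_mul, abs_div,
        abs_of_pos (lt_of_lt_of_le one_pos hd)]
      exact (div_le_self (abs_nonneg _) hd).trans (auxJ_bound n)
    rw [Real.dist_eq, div_sub_div _ _ hQ0.ne' hC.ne', abs_div, abs_of_pos (mul_pos hQ0 hC),
      div_div, mul_comm (cfQ _ n : ℝ) (Real.exp 1 + Real.exp (-1))]
    apply div_le_div₀ (by positivity) _ (by positivity)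
      (mul_le_mul_of_nonneg_left hQ hC.le)
    refine le_trans (le_of_eq (congrArg _ ?_)) hb
    ring
  · rw [Real.tanh_eq_sinh_div_cosh, Real.sinh_eq, Real.cosh_eq]
    field_simp
end

section
/- For an integer q ≥ 2, the continued fraction g_q = [q; q², q⁴, q⁸, …, q^{2^n}, …] satisfies the Davenport–Roth criterion: the quantity √(log n) · log(log Q_n) / n tends to infinity as n → ∞, where Q_n are the denominators of its convergents. (By the theorem of Davenport and Roth this implies that g_q is transcendental.) -/
open Filter Topology

theorem cfQ_pos_aux (a : ℕ → ℕ) (ha : ∀ k, 1 ≤ a k) : ∀ n, 1 ≤ cfQ a n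
  | 0 => by simp [cfQ]
  | 1 => by simpa [cfQ] using ha 1
  | n + 2 => by
    have := cfQ_pos_aux a ha n
    simp only [cfQ]
    omega

theorem cfQ_ge_aux (a : ℕ → ℕ) (ha : ∀ k, 1 ≤ a k) (n : ℕ) : a (n + 1) ≤ cfQ a (n + 1) := by
  cases n with
  | zero => simp [cfQ]
  | succ n =>
    have := cfQ_pos_aux a ha (n + 1)
    simp only [cfQ]
    nlinarith [ha (n + 1 + 1)]

/-- For an integer `q ≥ 2`, the continued fraction `g_q = [q; q², q⁴, q⁸, …]` with
partial quotients `a n = q^(2^n)` satisfies the Davenport–Roth criterion: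
`√(log n) · log (log Qₙ) / n → ∞` as `n → ∞`. -/
theorem g_q_satisfies_davenport_roth (q : ℕ) (hq : 2 ≤ q) :
    Tendsto
      (fun n : ℕ =>
        Real.sqrt (Real.log n) * Real.log (Real.log (cfQ (fun k => q ^ 2 ^ k) n)) / n)
      atTop atTop := by
  have hlog2 : (1 / 2 : ℝ) < Real.log 2 := by
    have := Real.log_two_gt_d9
    linarith
  have hbase : Tendsto (fun n : ℕ => Real.sqrt (Real.log n) * (Real.log 2 / 2)) atTop atTop :=
    (Real.tendsto_sqrt_atTop.comp
      (Real.tendsto_log_atTop.comp tendsto_natCast_atTop_atTop)).atTop_mul_const (by linarith)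
  refine tendsto_atTop_mono' _ ?_ hbase
  filter_upwards [eventually_ge_atTop 2] with n hn
  have hnR : (2 : ℝ) ≤ n := by exact_mod_cast hn
  have hQ : 2 ^ 2 ^ n ≤ cfQ (fun k => q ^ 2 ^ k) n := by
    obtain ⟨m, rfl⟩ : ∃ m, n = m + 1 := ⟨n - 1, by omega⟩
    refine (Nat.pow_le_pow_left hq _).trans ?_
    exact cfQ_ge_aux (fun k => q ^ 2 ^ k) (fun k => Nat.one_le_pow _ _ (by omega)) m
  have hQR : (2 : ℝ) ^ 2 ^ n ≤ (cfQ (fun k => q ^ 2 ^ k) n : ℝ) := by exact_mod_cast hQ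
  generalize (cfQ (fun k => q ^ 2 ^ k) n : ℝ) = Q at hQR ⊢
  have h1 : (2 : ℝ) ^ n * (1 / 2) ≤ Real.log Q := by
    have := Real.log_le_log (by positivity) hQR
    rw [Real.log_pow] at this
    push_cast at this
    have h2 : (0 : ℝ) < 2 ^ n := by positivity
    nlinarith
  have h2 : n * Real.log 2 - Real.log 2 ≤ Real.log (Real.log Q) := by
    have := Real.log_le_log (by positivity) h1
    rw [Real.log_mul (by positivity) (by norm_num), Real.log_pow, one_div, Real.log_inv] at this
    linarith
  rw [mul_div_assoc]
  refine mul_le_mul_of_nonneg_left ?_ (Real.sqrt_nonneg _)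
  rw [le_div_iff₀ (by linarith)]
  nlinarith
end

section
/- Let γ be the Euler–Mascheroni constant and set c = 1/(2^{e^{−γ}} − 1). Let a be a sequence of positive integers with a(n) ≥ 2^{2^{n·e^{−γ}}} for all n ≥ 1 (the growth asserted by Wagstaff's conjecture for the n-th Mersenne prime). Then the denominators Q_n of the convergents of [0; a(1), a(2), …] satisfy Q_n ≥ 2^{c·(2^{(n+1)e^{−γ}} − 2^{e^{−γ}})} for all n ≥ 1, and consequently √(log n) · log(log Q_n)/n tends to infinity as n → ∞, so the Davenport–Roth criterion for transcendence is satisfied. -/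
open Filter Topology Real

/-- Let `γ` be the Euler–Mascheroni constant and `c = 1/(2^(e^(−γ)) − 1)`. If the partial
quotients satisfy `a n ≥ 2^(2^(n·e^(−γ)))` (Wagstaff's conjectured growth of Mersenne
primes), then `Qₙ ≥ 2^(c·(2^((n+1)e^(−γ)) − 2^(e^(−γ))))` for all `n ≥ 1`, and
`√(log n) · log (log Qₙ)/n → ∞`, so the Davenport–Roth criterion is fulfilled. -/
theorem wagstaff_growth_satisfies_davenport_roth
    (γ c : ℝ) (hγ : γ = Real.eulerMascheroniConstant)
    (hc : c = 1 / ((2 : ℝ) ^ (Real.exp (-γ)) - 1))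
    (a : ℕ → ℕ) (hpos : ∀ n, 1 ≤ n → 0 < a n)
    (ha : ∀ n : ℕ, 1 ≤ n → (2 : ℝ) ^ ((2 : ℝ) ^ ((n : ℝ) * Real.exp (-γ))) ≤ (a n : ℝ)) :
    (∀ n : ℕ, 1 ≤ n →
        (2 : ℝ) ^ (c * ((2 : ℝ) ^ (((n : ℝ) + 1) * Real.exp (-γ)) -
          (2 : ℝ) ^ (Real.exp (-γ)))) ≤ (cfQ a n : ℝ)) ∧
      Tendsto
        (fun n : ℕ => Real.sqrt (Real.log n) * Real.log (Real.log (cfQ a n)) / n)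
        atTop atTop := by
  clear hγ hpos
  set k := Real.exp (-γ) with hk
  have hk0 : 0 < k := Real.exp_pos _
  have hr : (1 : ℝ) < (2 : ℝ) ^ k := Real.one_lt_rpow (by norm_num) hk0
  have hrec : ∀ n : ℕ, (a (n + 1) : ℝ) * (cfQ a n : ℝ) ≤ (cfQ a (n + 1) : ℝ) := by
    intro n
    cases n with
    | zero => simp [cfQ]
    | succ m =>
      have h : a (m + 2) * cfQ a (m + 1) ≤ cfQ a (m + 2) := by
        rw [cfQ]; exact Nat.le_add_right _ _
      exact_mod_cast h
  have key : ∀ n : ℕ, (2 : ℝ) ^ (c * ((2 : ℝ) ^ (((n : ℝ) + 1) * k) - (2 : ℝ) ^ k))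
      ≤ (cfQ a n : ℝ) := by
    intro n
    induction n with
    | zero => simp [cfQ]
    | succ m ih =>
      refine le_trans ?_ (hrec m)
      have h1 := ha (m + 1) (by omega)
      refine le_trans ?_ (mul_le_mul h1 ih (by positivity) (by positivity))
      rw [← Real.rpow_add (by norm_num)]
      apply le_of_eq
      congr 1
      have e : (2 : ℝ) ^ ((((m + 1 : ℕ) : ℝ) + 1) * k)
          = (2 : ℝ) ^ (((m : ℝ) + 1) * k) * (2 : ℝ) ^ k := by
        rw [← Real.rpow_add (by norm_num)]
        congr 1
        push_cast
        ring
      rw [e, hc]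
      have hne : (2 : ℝ) ^ k - 1 ≠ 0 := by linarith
      push_cast
      field_simp
      ring
  refine ⟨fun n _ => key n, ?_⟩
  have hQ1 : ∀ n : ℕ, (1 : ℝ) ≤ (cfQ a n : ℝ) := by
    intro n
    refine le_trans ?_ (key n)
    apply Real.one_le_rpow (by norm_num)
    have hc0 : 0 ≤ c := by rw [hc]; apply one_div_nonneg.2; linarith
    apply mul_nonneg hc0
    rw [sub_nonneg]
    apply Real.rpow_le_rpow_of_exponent_le (by norm_num)
    have : (0 : ℝ) ≤ n := Nat.cast_nonneg n
    nlinarith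
  have hl2 : 0 < Real.log 2 := Real.log_pos (by norm_num)
  have hlow : ∀ n : ℕ, 1 ≤ n →
      (n : ℝ) * k * Real.log 2 + Real.log (Real.log 2) ≤ Real.log (Real.log (cfQ a n)) := by
    intro n hn
    obtain ⟨m, rfl⟩ : ∃ m, n = m + 1 := ⟨n - 1, by omega⟩
    have h1 := ha (m + 1) hn
    have h2 : (2 : ℝ) ^ ((2 : ℝ) ^ (((m + 1 : ℕ) : ℝ) * k)) ≤ (cfQ a (m + 1) : ℝ) := by
      refine le_trans h1 (le_trans ?_ (hrec m))
      exact le_mul_of_one_le_right (Nat.cast_nonneg _) (hQ1 m)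
    have h3 := Real.log_le_log (by positivity) h2
    rw [Real.log_rpow (by norm_num)] at h3
    have h4 := Real.log_le_log (by positivity) h3
    rw [Real.log_mul (by positivity) hl2.ne', Real.log_rpow (by norm_num)] at h4
    exact h4
  have hT : Tendsto (fun n : ℕ => Real.sqrt (Real.log n) *
      (k * Real.log 2 + Real.log (Real.log 2) / n)) atTop atTop := by
    apply Tendsto.atTop_mul_pos (C := k * Real.log 2) (by positivity)
    · exact Real.tendsto_sqrt_atTop.comp
        (Real.tendsto_log_atTop.comp tendsto_natCast_atTop_atTop)
    · simpa using (tendsto_const_nhds (x := k * Real.log 2)).add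
        (tendsto_const_div_atTop_nhds_zero_nat (Real.log (Real.log 2)))
  refine tendsto_atTop_mono' _ ?_ hT
  filter_upwards [eventually_ge_atTop 1] with n hn
  have hn0 : (0 : ℝ) < n := by exact_mod_cast hn
  rw [mul_div_assoc]
  apply mul_le_mul_of_nonneg_left _ (Real.sqrt_nonneg _)
  rw [le_div_iff₀ hn0]
  refine le_trans (le_of_eq ?_) (hlow n hn)
  field_simp
end

section
/- For the continued fraction f = [0; 1!, 2!, 3!, …, n!, …] with partial quotients a(n) = n!, the Davenport–Roth quantity tends to zero: √(log n) · log(log Q_n)/n → 0 as n → ∞, where Q_n are the denominators of the convergents; hence the transcendence of f cannot be deduced from the Davenport–Roth theorem. -/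
open Filter Topology

lemma cfQ_pos_aux_s14 (n : ℕ) : 1 ≤ cfQ Nat.factorial n ∧ 1 ≤ cfQ Nat.factorial (n + 1) := by
  induction n with
  | zero => simp [cfQ]
  | succ k ih =>
    refine ⟨ih.2, ?_⟩
    rw [cfQ]
    have := ih.1
    omega

lemma cfQ_ge (n : ℕ) (hn : 2 ≤ n) : n ≤ cfQ Nat.factorial n := by
  obtain ⟨k, rfl⟩ := Nat.exists_eq_add_of_le' hn
  rw [cfQ]
  have h1 := (cfQ_pos_aux_s14 k).2
  have h2 := Nat.self_le_factorial (k + 2)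
  have h3 := Nat.mul_le_mul h2 h1
  omega

lemma cfQ_le_aux (N n : ℕ) :
    (n ≤ N → cfQ Nat.factorial n ≤ (N.factorial + 1) ^ n) ∧
    (n + 1 ≤ N → cfQ Nat.factorial (n + 1) ≤ (N.factorial + 1) ^ (n + 1)) := by
  induction n with
  | zero => simp [cfQ]
  | succ k ih =>
    refine ⟨ih.2, fun h => ?_⟩
    have h1 := ih.1 (by omega)
    have h2 := ih.2 (by omega)
    have h3 : (k + 2).factorial ≤ N.factorial := Nat.factorial_le h
    rw [cfQ]
    calc _ ≤ N.factorial * (N.factorial + 1) ^ (k + 1) + (N.factorial + 1) ^ (k + 1) := by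
          gcongr
          exact h1.trans (Nat.pow_le_pow_right (by omega) (by omega))
      _ = _ := by ring

lemma cfQ_log_le (n : ℕ) (hn : 2 ≤ n) : Real.log (cfQ Nat.factorial n) ≤ (n : ℝ) ^ 3 := by
  have h1 := (cfQ_le_aux n n).1 le_rfl
  have h2 : n.factorial + 1 ≤ (n + 1) ^ n := by
    have a : n.factorial ≤ n ^ n := Nat.factorial_le_pow n
    have b : n ^ n < (n + 1) ^ n := Nat.pow_lt_pow_left (by omega) (by omega)
    omega
  have h3 : cfQ Nat.factorial n ≤ ((n + 1) ^ n) ^ n := h1.trans (Nat.pow_le_pow_left h2 n)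
  have h4 : (cfQ Nat.factorial n : ℝ) ≤ (((n : ℝ) + 1) ^ n) ^ n := by exact_mod_cast h3
  have h0 : (0 : ℝ) < cfQ Nat.factorial n := by exact_mod_cast (cfQ_pos_aux_s14 n).1
  have h5 := Real.log_le_log h0 h4
  rw [Real.log_pow, Real.log_pow] at h5
  have h6 : Real.log ((n : ℝ) + 1) ≤ n := by
    have := Real.log_le_sub_one_of_pos (show (0 : ℝ) < n + 1 by positivity)
    linarith
  calc _ ≤ _ := h5
    _ ≤ (n : ℝ) * (n * n) := by gcongr
    _ = _ := by ring

/-- For the continued fraction `f = [0; 1!, 2!, 3!, …]` with partial quotients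
`a n = n!`, the Davenport–Roth quantity `√(log n) · log (log Qₙ)/n` tends to `0`, so the
transcendence of `f` cannot be deduced from the Davenport–Roth theorem. -/
theorem factorial_contfrac_davenport_roth_quantity_tendsto_zero :
    Tendsto
      (fun n : ℕ =>
        Real.sqrt (Real.log n) * Real.log (Real.log (cfQ Nat.factorial n)) / n)
      atTop (𝓝 0) := by
  have hl : Tendsto (fun n : ℕ => 3 * (Real.log n ^ 2 / (n : ℝ))) atTop (𝓝 0) := by
    have h := (Real.isLittleO_pow_log_id_atTop (n := 2)).tendsto_div_nhds_zero
    have h' := (h.comp tendsto_natCast_atTop_atTop).const_mul 3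
    simpa [Function.comp_def] using h'
  have key : ∀ n : ℕ, 3 ≤ n → 1 ≤ Real.log n ∧ 1 ≤ Real.log (cfQ Nat.factorial n) := by
    intro n hn
    have hn' : (3 : ℝ) ≤ n := by exact_mod_cast hn
    have h1 : 1 ≤ Real.log n := by
      rw [Real.le_log_iff_exp_le (by linarith)]
      linarith [Real.exp_one_lt_d9]
    refine ⟨h1, h1.trans (Real.log_le_log (by linarith) ?_)⟩
    exact_mod_cast cfQ_ge n (by omega)
  refine squeeze_zero' ?_ ?_ hl
  · filter_upwards [eventually_ge_atTop 3] with n hn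
    have := Real.log_nonneg (key n hn).2
    positivity
  · filter_upwards [eventually_ge_atTop 3] with n hn
    obtain ⟨h1, h2⟩ := key n hn
    have h3 : Real.log (Real.log (cfQ Nat.factorial n)) ≤ 3 * Real.log n := by
      have := Real.log_le_log (by linarith) (cfQ_log_le n (by omega))
      rw [Real.log_pow] at this
      exact_mod_cast this
    have h4 : Real.sqrt (Real.log n) ≤ Real.log n := by
      rw [Real.sqrt_le_left (by linarith)]
      nlinarith
    have h5 := Real.log_nonneg h2
    calc _ ≤ Real.log n * (3 * Real.log n) / n := by gcongr
      _ = _ := by ring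
end

section
/- The real number u defined as the limit of the convergents of the simple continued fraction [0; 2, 3, 5, 7, 11, …] whose partial quotients are the prime numbers in increasing order has irrationality measure μ(u) = 2; that is: (i) for every δ > 2 there exist only finitely many pairs of integers (P, Q) with Q ≥ 1 and 0 < |u − P/Q| < 1/Q^δ, and (ii) there exist infinitely many pairs of integers (P, Q) with Q ≥ 1 and 0 < |u − P/Q| < 1/Q². -/
open Filter Topology

/-- The `n`-th prime number: `nthPrime 1 = 2`, `nthPrime 2 = 3`, `nthPrime 3 = 5`, …. -/
noncomputable def nthPrime (n : ℕ) : ℕ := Nat.nth Nat.Prime (n - 1)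

section helper

theorem hp_lower (n : ℕ) (hn : 1 ≤ n) : n + 1 ≤ nthPrime n := by
  have := Nat.add_two_le_nth_prime (n - 1)
  unfold nthPrime
  omega

theorem hp_upper (n : ℕ) : nthPrime (n + 1) ≤ 2 ^ (n + 1) := by
  unfold nthPrime
  simp only [Nat.add_sub_cancel]
  induction n with
  | zero => simp
  | succ n ih =>
    have h0 : Nat.nth Nat.Prime n ≠ 0 := by
      have := Nat.add_two_le_nth_prime n
      omega
    obtain ⟨p, hp, h1, h2⟩ := Nat.exists_prime_lt_and_le_two_mul _ h0
    have h3 : n < Nat.count Nat.Prime p := by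
      rw [← Nat.nth_lt_nth Nat.infinite_setOfPred_prime, Nat.nth_count hp]
      exact h1
    have h4 : Nat.nth Nat.Prime (n + 1) ≤ p := by
      conv_rhs => rw [← Nat.nth_count hp]
      exact (Nat.nth_le_nth Nat.infinite_setOfPred_prime).2 h3
    rw [pow_succ]
    omega

variable (a : ℕ → ℕ)

theorem cfQ_rec (n : ℕ) : cfQ a (n + 2) = a (n + 2) * cfQ a (n + 1) + cfQ a n := by
  rw [cfQ]

theorem cfP_rec (n : ℕ) : cfP a (n + 2) = a (n + 2) * cfP a (n + 1) + cfP a n := by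
  rw [cfP]

theorem cf_det (n : ℕ) :
    (cfP a (n + 1) : ℝ) * cfQ a n - cfP a n * cfQ a (n + 1) = (-1) ^ n := by
  induction n with
  | zero => simp [cfP, cfQ]
  | succ n ih =>
    rw [cfP_rec, cfQ_rec, pow_succ, ← ih]
    push_cast
    ring

theorem cfQ_fact (ha : ∀ n, 1 ≤ n → n + 1 ≤ a n) (n : ℕ) : n.factorial ≤ cfQ a n := by
  induction n using Nat.strong_induction_on with
  | _ n ih =>
    match n with
    | 0 => simp [cfQ]
    | 1 => have := ha 1 le_rfl; simp [cfQ]; omega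
    | n + 2 =>
      have h1 := ih (n + 1) (by omega)
      have h2 := ha (n + 2) (by omega)
      rw [cfQ_rec, Nat.factorial_succ]
      have := Nat.mul_le_mul (show n + 1 + 1 ≤ a (n + 2) by omega) h1
      omega

theorem cfQ_pos (ha : ∀ n, 1 ≤ n → n + 1 ≤ a n) (n : ℕ) : 0 < cfQ a n :=
  lt_of_lt_of_le (Nat.factorial_pos n) (cfQ_fact a ha n)

theorem cfQ_two (ha : ∀ n, 1 ≤ n → n + 1 ≤ a n) (n : ℕ) : 2 * cfQ a n ≤ cfQ a (n + 1) := by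
  match n with
  | 0 => have := ha 1 le_rfl; simp [cfQ]; omega
  | n + 1 =>
    rw [cfQ_rec]
    have := Nat.mul_le_mul_right (cfQ a (n + 1)) (show 2 ≤ a (n + 2) by have := ha (n+2); omega)
    omega

theorem cfQ_strictMono (ha : ∀ n, 1 ≤ n → n + 1 ≤ a n) : StrictMono (cfQ a) :=
  strictMono_nat_of_lt_succ fun n => by
    have := cfQ_two a ha n
    have := cfQ_pos a ha n
    omega

theorem cfQ_upper (ha : ∀ n, 1 ≤ n → n + 1 ≤ a n) (n : ℕ) :
    cfQ a (n + 1) ≤ (a (n + 1) + 1) * cfQ a n := by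
  match n with
  | 0 => simp [cfQ]
  | n + 1 =>
    rw [cfQ_rec, add_mul, show n + 1 + 1 = n + 2 from rfl]
    have := (cfQ_strictMono a ha).monotone (Nat.le_succ n)
    simp only [Nat.succ_eq_add_one] at this
    omega

theorem conv_step (ha : ∀ n, 1 ≤ n → n + 1 ≤ a n) (n : ℕ) :
    0 < (-1 : ℝ) ^ n * ((cfP a (n + 2) : ℝ) / cfQ a (n + 2) - (cfP a n : ℝ) / cfQ a n) := by
  have h0 : (0 : ℝ) < cfQ a n := by exact_mod_cast cfQ_pos a ha n
  have h2 : (0 : ℝ) < cfQ a (n + 2) := by exact_mod_cast cfQ_pos a ha (n + 2)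
  have h3 : (0 : ℝ) < a (n + 2) := by
    have := ha (n + 2) (by omega)
    exact_mod_cast (by omega : 0 < a (n + 2))
  have hd := cf_det a n
  have hs : ((-1 : ℝ) ^ n) * (-1) ^ n = 1 := by rw [← mul_pow]; simp
  have key : (cfP a (n + 2) : ℝ) * cfQ a n - cfQ a (n + 2) * cfP a n = a (n + 2) * (-1) ^ n := by
    rw [← hd, cfP_rec, cfQ_rec]
    push_cast
    ring
  rw [div_sub_div _ _ h2.ne' h0.ne', key, ← mul_div_assoc]
  have : (-1 : ℝ) ^ n * (a (n + 2) * (-1) ^ n) = a (n + 2) := by linear_combination (a (n+2) : ℝ) * hs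
  rw [this]
  positivity

theorem sgn_pos (ha : ∀ n, 1 ≤ n → n + 1 ≤ a n) (u : ℝ)
    (hu : Tendsto (fun n => (cfP a n : ℝ) / (cfQ a n : ℝ)) atTop (𝓝 u)) (n : ℕ) :
    0 < (-1 : ℝ) ^ n * (cfQ a n * u - cfP a n) := by
  have h0 : (0 : ℝ) < cfQ a n := by exact_mod_cast cfQ_pos a ha n
  set f : ℕ → ℝ := fun k => (-1 : ℝ) ^ n * ((cfP a (n + 2 * k) : ℝ) / cfQ a (n + 2 * k)) with hf
  have hmono : StrictMono f := strictMono_nat_of_lt_succ fun k => by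
    have := conv_step a ha (n + 2 * k)
    rw [pow_add, pow_mul] at this
    simp only [even_two, Even.neg_pow, one_pow, mul_one] at this
    simp only [hf]
    rw [show n + 2 * (k + 1) = n + 2 * k + 2 by ring]
    linarith
  have hlim : Tendsto f atTop (𝓝 ((-1 : ℝ) ^ n * u)) := by
    apply Tendsto.const_mul
    apply hu.comp
    apply tendsto_atTop_mono (fun k => (by omega : k ≤ n + 2 * k)) tendsto_id
  have h1 : f 1 ≤ (-1 : ℝ) ^ n * u := hmono.monotone.ge_of_tendsto hlim 1
  have h2 : f 0 < f 1 := hmono (by norm_num)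
  have h3 : f 0 = (-1 : ℝ) ^ n * ((cfP a n : ℝ) / cfQ a n) := by simp [hf]
  have h4 : 0 < ((-1 : ℝ) ^ n * u - (-1 : ℝ) ^ n * ((cfP a n : ℝ) / cfQ a n)) * cfQ a n := by
    apply mul_pos _ h0
    linarith
  convert h4 using 1
  field_simp

theorem err_pos (ha : ∀ n, 1 ≤ n → n + 1 ≤ a n) (u : ℝ)
    (hu : Tendsto (fun n => (cfP a n : ℝ) / (cfQ a n : ℝ)) atTop (𝓝 u)) (n : ℕ) :
    0 < |cfQ a n * u - cfP a n| := by
  have := sgn_pos a ha u hu n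
  rw [abs_pos]
  rintro h
  simp [h] at this

theorem err_rel (ha : ∀ n, 1 ≤ n → n + 1 ≤ a n) (u : ℝ)
    (hu : Tendsto (fun n => (cfP a n : ℝ) / (cfQ a n : ℝ)) atTop (𝓝 u)) (n : ℕ) :
    cfQ a (n + 1) * |cfQ a n * u - cfP a n| + cfQ a n * |cfQ a (n + 1) * u - cfP a (n + 1)| = 1 := by
  have habs : ∀ m, |cfQ a m * u - cfP a m| = (-1 : ℝ) ^ m * (cfQ a m * u - cfP a m) := by
    intro m
    rw [← abs_of_pos (sgn_pos a ha u hu m), abs_mul]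
    simp
  rw [habs, habs, pow_succ]
  have hs : ((-1 : ℝ) ^ n) * (-1) ^ n = 1 := by rw [← mul_pow]; simp
  have hd := cf_det a n
  linear_combination hs + (-1 : ℝ) ^ n * hd

theorem err_upper (ha : ∀ n, 1 ≤ n → n + 1 ≤ a n) (u : ℝ)
    (hu : Tendsto (fun n => (cfP a n : ℝ) / (cfQ a n : ℝ)) atTop (𝓝 u)) (n : ℕ) :
    cfQ a (n + 1) * |cfQ a n * u - cfP a n| < 1 := by
  have h0 : (0 : ℝ) < cfQ a n := by exact_mod_cast cfQ_pos a ha n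
  have := err_rel a ha u hu n
  have := mul_pos h0 (err_pos a ha u hu (n + 1))
  linarith

theorem err_lower (ha : ∀ n, 1 ≤ n → n + 1 ≤ a n) (u : ℝ)
    (hu : Tendsto (fun n => (cfP a n : ℝ) / (cfQ a n : ℝ)) atTop (𝓝 u)) (n : ℕ) :
    1 ≤ 2 * (cfQ a (n + 1) * |cfQ a n * u - cfP a n|) := by
  have h1 := err_rel a ha u hu n
  have h2 := err_upper a ha u hu (n + 1)
  have h3 : (2 * cfQ a n : ℝ) ≤ cfQ a (n + 1 + 1) := by
    have h4 := cfQ_two a ha n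
    have h5 := cfQ_two a ha (n + 1)
    exact_mod_cast (by omega : 2 * cfQ a n ≤ cfQ a (n + 1 + 1))
  have h4 := mul_le_mul_of_nonneg_right h3 (err_pos a ha u hu (n + 1)).le
  linarith

/-- The main lower bound. -/
theorem main_lower (ha : ∀ n, 1 ≤ n → n + 1 ≤ a n) (u : ℝ)
    (hu : Tendsto (fun n => (cfP a n : ℝ) / (cfQ a n : ℝ)) atTop (𝓝 u)) (P Q : ℤ) (hQ : 1 ≤ Q) :
    ∃ n, (cfQ a n : ℝ) ≤ 2 * Q ∧
      1 ≤ 8 * ((a (n + 1) : ℝ) + 1) * (Q : ℝ) ^ 2 * |u - (P : ℝ) / (Q : ℝ)| := by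
  have hex : ∃ m, 2 * Q < (cfQ a m : ℤ) := by
    obtain ⟨q, rfl⟩ := Int.eq_ofNat_of_zero_le (by omega : 0 ≤ Q)
    refine ⟨2 * q + 1, ?_⟩
    have := (cfQ_strictMono a ha).le_apply (x := 2 * q + 1)
    omega
  classical
  obtain ⟨n, hn⟩ : ∃ n, Nat.find hex = n + 1 := by
    apply Nat.exists_eq_succ_of_ne_zero
    intro h
    have := Nat.find_spec hex
    rw [h] at this
    simp [cfQ] at this
    omega
  have h1 : 2 * Q < (cfQ a (n + 1) : ℤ) := hn ▸ Nat.find_spec hex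
  have h2 : (cfQ a n : ℤ) ≤ 2 * Q := not_lt.1 (Nat.find_min hex (by omega))
  have h1' : 2 * (Q : ℝ) < cfQ a (n + 1) := by exact_mod_cast h1
  have h2' : (cfQ a n : ℝ) ≤ 2 * Q := by exact_mod_cast h2
  refine ⟨n, h2', ?_⟩
  have hq : (0 : ℝ) < cfQ a n := by exact_mod_cast cfQ_pos a ha n
  have hQ' : (0 : ℝ) < Q := by exact_mod_cast (by omega : 0 < Q)
  set e := |cfQ a n * u - cfP a n| with he
  have he0 : 0 < e := err_pos a ha u hu n
  have heu := err_upper a ha u hu n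
  have hel := err_lower a ha u hu n
  rw [← he] at heu hel
  set d := |u - (P : ℝ) / (Q : ℝ)| with hd
  have hd0 : 0 ≤ d := abs_nonneg _
  have ha0 : (0 : ℝ) ≤ a (n + 1) := Nat.cast_nonneg _
  have hQd : |Q * u - P| = Q * d := by
    rw [hd, ← abs_of_pos hQ', ← abs_mul, abs_of_pos hQ']
    congr 1
    field_simp
  by_cases hc : Q * cfP a n - P * cfQ a n = 0
  · have hc' : (Q : ℝ) * cfP a n = P * cfQ a n := by
      have : Q * cfP a n = P * cfQ a n := by omega
      exact_mod_cast this
    have hed : e = cfQ a n * d := by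
      rw [he, hd, ← abs_of_pos hq, ← abs_mul, abs_of_pos hq]
      congr 1
      field_simp
      linear_combination -hc'
    have hup : (cfQ a (n + 1) : ℝ) ≤ (a (n + 1) + 1) * cfQ a n := by
      exact_mod_cast cfQ_upper a ha n
    have hsq : (cfQ a n : ℝ) ^ 2 ≤ 4 * Q ^ 2 := by nlinarith
    calc (1 : ℝ) ≤ 2 * (cfQ a (n + 1) * e) := hel
      _ ≤ 2 * (((a (n + 1) + 1) * cfQ a n) * e) := by gcongr
      _ = 2 * (a (n + 1) + 1) * (cfQ a n ^ 2) * d := by rw [hed]; ring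
      _ ≤ 2 * (a (n + 1) + 1) * (4 * Q ^ 2) * d := by gcongr
      _ = _ := by ring
  · have hc1 : (1 : ℝ) ≤ |(Q : ℝ) * cfP a n - P * cfQ a n| := by
      have := Int.one_le_abs hc
      exact_mod_cast this
    have hc2 : |(Q : ℝ) * cfP a n - P * cfQ a n| ≤ cfQ a n * (Q * d) + Q * e := by
      rw [← hQd, he]
      calc _ = |cfQ a n * (Q * u - P) - Q * (cfQ a n * u - cfP a n)| := by congr 1; ring
        _ ≤ |cfQ a n * (Q * u - P)| + |Q * (cfQ a n * u - cfP a n)| := abs_sub _ _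
        _ = _ := by rw [abs_mul, abs_mul, abs_of_pos hq, abs_of_pos hQ']
    have h5 : 2 * Q * e ≤ 1 := by nlinarith
    have h6 : (cfQ a n : ℝ) * (Q * d) ≤ 2 * Q * (Q * d) := by gcongr
    have h7 : 0 ≤ (a (n + 1) : ℝ) * (Q ^ 2 * d) := by positivity
    have h8 : 0 ≤ (Q ^ 2 * d) := by positivity
    nlinarith

theorem Q_bdd (ha : ∀ n, 1 ≤ n → n + 1 ≤ a n) (hb : ∀ n, a (n + 1) ≤ 2 ^ (n + 1)) (u : ℝ)
    (hu : Tendsto (fun n => (cfP a n : ℝ) / (cfQ a n : ℝ)) atTop (𝓝 u)) (δ : ℝ) (hδ : 2 < δ) :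
    ∃ M : ℝ, ∀ P Q : ℤ, 1 ≤ Q → |u - (P : ℝ) / (Q : ℝ)| < 1 / (Q : ℝ) ^ δ → (Q : ℝ) ≤ M := by
  set ε := δ - 2 with hε
  have hε0 : 0 < ε := by linarith
  set K : ℝ := 2 ^ (1 / ε) with hK
  have hK0 : 0 < K := by positivity
  set D : ℝ := 32 ^ (1 / ε) with hD
  have hD0 : 0 < D := by positivity
  have hlim := FloorSemiring.tendsto_pow_div_factorial_atTop K
  have hev := hlim.eventually (gt_mem_nhds (show (0 : ℝ) < 1 / (2 * D) by positivity))
  obtain ⟨N, hN⟩ := eventually_atTop.1 hev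
  refine ⟨D * K ^ N + D, fun P Q hQ h => ?_⟩
  have hQ' : (0 : ℝ) < Q := by exact_mod_cast (by omega : 0 < Q)
  obtain ⟨n, hn1, hn2⟩ := main_lower a ha u hu P Q hQ
  have hA : 8 * ((a (n + 1) : ℝ) + 1) ≤ 32 * 2 ^ n := by
    have h1 : (a (n + 1) : ℝ) ≤ 2 ^ (n + 1) := by exact_mod_cast hb n
    have h2 : (1 : ℝ) ≤ 2 ^ n := one_le_pow₀ (by norm_num)
    rw [pow_succ] at h1
    linarith
  have hpow : (Q : ℝ) ^ δ = Q ^ 2 * (Q : ℝ) ^ ε := by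
    rw [← Real.rpow_natCast, ← Real.rpow_add hQ']
    congr 1
    push_cast
    linarith
  have hQe : 0 < (Q : ℝ) ^ ε := by positivity
  have h3 : (Q : ℝ) ^ ε ≤ 32 * 2 ^ n := by
    rw [hpow, lt_div_iff₀ (by positivity)] at h
    set d := |u - (P : ℝ) / (Q : ℝ)| with hd
    have hd0 : 0 ≤ d := abs_nonneg _
    have h4 : 1 ≤ (32 * 2 ^ n) * ((Q : ℝ) ^ 2 * d) := by
      calc (1 : ℝ) ≤ _ := hn2
        _ ≤ (32 * 2 ^ n) * (Q : ℝ) ^ 2 * d := by gcongr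
        _ = _ := by ring
    calc (Q : ℝ) ^ ε = (Q : ℝ) ^ ε * 1 := by ring
      _ ≤ (Q : ℝ) ^ ε * ((32 * 2 ^ n) * ((Q : ℝ) ^ 2 * d)) := by gcongr
      _ = (32 * 2 ^ n) * (d * (Q ^ 2 * (Q : ℝ) ^ ε)) := by ring
      _ ≤ (32 * 2 ^ n) * 1 := by gcongr
      _ = _ := by ring
  have h5 : (Q : ℝ) ≤ D * K ^ n := by
    have := Real.rpow_le_rpow hQe.le h3 (show 0 ≤ 1 / ε by positivity)
    rw [← Real.rpow_mul hQ'.le, mul_one_div_cancel hε0.ne', Real.rpow_one,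
      Real.mul_rpow (by norm_num) (by positivity)] at this
    refine this.trans_eq ?_
    rw [hD, hK, ← Real.rpow_natCast, ← Real.rpow_natCast, ← Real.rpow_mul (by norm_num),
      ← Real.rpow_mul (by norm_num), mul_comm (n : ℝ)]
  have hnN : n < N := by
    by_contra hcon
    have h6 := hN n (by omega)
    have h7 : (n.factorial : ℝ) ≤ cfQ a n := by exact_mod_cast cfQ_fact a ha n
    have h8 : (0 : ℝ) < n.factorial := by exact_mod_cast Nat.factorial_pos n
    rw [div_lt_div_iff₀ h8 (by positivity)] at h6
    nlinarith
  have hK1 : 1 ≤ K := Real.one_le_rpow (by norm_num) (by positivity)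
  have : K ^ n ≤ K ^ N := pow_le_pow_right₀ hK1 hnN.le
  nlinarith

end helper

/-- The value `u` of the continued fraction `[0; 2, 3, 5, 7, 11, …]` built from the
primes has irrationality measure `μ(u) = 2`: (i) for every `δ > 2` there are only
finitely many integer pairs `(P, Q)`, `Q ≥ 1`, with `0 < |u − P/Q| < 1/Q^δ`, and
(ii) there are infinitely many integer pairs `(P, Q)`, `Q ≥ 1`, with
`0 < |u − P/Q| < 1/Q²`. -/
theorem irrationality_measure_contfrac_primes_eq_two (u : ℝ)
    (hu : Tendsto (fun n => (cfP nthPrime n : ℝ) / (cfQ nthPrime n : ℝ)) atTop (𝓝 u)) :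
    (∀ δ : ℝ, 2 < δ →
      {PQ : ℤ × ℤ | 1 ≤ PQ.2 ∧ 0 < |u - (PQ.1 : ℝ) / (PQ.2 : ℝ)| ∧
        |u - (PQ.1 : ℝ) / (PQ.2 : ℝ)| < 1 / (PQ.2 : ℝ) ^ δ}.Finite) ∧
    {PQ : ℤ × ℤ | 1 ≤ PQ.2 ∧ 0 < |u - (PQ.1 : ℝ) / (PQ.2 : ℝ)| ∧
        |u - (PQ.1 : ℝ) / (PQ.2 : ℝ)| < 1 / (PQ.2 : ℝ) ^ 2}.Infinite := by
  refine ⟨fun δ hδ => ?_, ?_⟩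
  · obtain ⟨M, hM⟩ := Q_bdd nthPrime hp_lower hp_upper u hu δ hδ
    refine Set.Finite.subset
      ((Set.finite_Icc (-⌈M * (|u| + 1)⌉) ⌈M * (|u| + 1)⌉).prod (Set.finite_Icc 1 ⌈M⌉)) ?_
    rintro ⟨P, Q⟩ ⟨hQ, -, h⟩
    simp only at hQ h
    have hQM := hM P Q hQ h
    have hQ1 : (1 : ℝ) ≤ Q := by exact_mod_cast hQ
    have hQ0 : (0 : ℝ) < Q := by linarith
    have h1 : (1 : ℝ) ≤ (Q : ℝ) ^ δ := Real.one_le_rpow hQ1 (by linarith)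
    have h2 : |u - (P : ℝ) / Q| ≤ 1 := h.le.trans (by rw [div_le_one (by linarith)]; exact h1)
    have h3 : |(P : ℝ) / Q| ≤ |u| + 1 := by
      have := abs_sub_abs_le_abs_sub ((P : ℝ) / Q) u
      rw [abs_sub_comm] at this
      linarith
    rw [abs_div, abs_of_pos hQ0, div_le_iff₀ hQ0] at h3
    have h4 : |(P : ℝ)| ≤ M * (|u| + 1) := by
      have := abs_nonneg u
      nlinarith
    have h5 : |P| ≤ ⌈M * (|u| + 1)⌉ := by
      have := h4.trans (Int.le_ceil _)
      exact_mod_cast this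
    have h6 : Q ≤ ⌈M⌉ := by
      have := hQM.trans (Int.le_ceil _)
      exact_mod_cast this
    exact ⟨abs_le.1 h5, hQ, h6⟩
  · refine Set.infinite_of_injective_forall_mem
      (f := fun n : ℕ => ((cfP nthPrime n : ℤ), (cfQ nthPrime n : ℤ))) ?_ ?_
    · intro m n h
      have h2 : (cfQ nthPrime m : ℤ) = cfQ nthPrime n := congrArg Prod.snd h
      exact (cfQ_strictMono nthPrime hp_lower).injective (by exact_mod_cast h2)
    · intro n
      have hq : (0 : ℝ) < cfQ nthPrime n := by exact_mod_cast cfQ_pos nthPrime hp_lower n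
      have he := err_pos nthPrime hp_lower u hu n
      have hu' := err_upper nthPrime hp_lower u hu n
      have hm : (cfQ nthPrime n : ℝ) ≤ cfQ nthPrime (n + 1) := by
        exact_mod_cast (cfQ_strictMono nthPrime hp_lower).monotone (Nat.le_succ n)
      have key : |u - (cfP nthPrime n : ℝ) / cfQ nthPrime n| * cfQ nthPrime n =
          |cfQ nthPrime n * u - cfP nthPrime n| := by
        conv_lhs => rw [← abs_of_pos hq, ← abs_mul, abs_of_pos hq]
        congr 1
        field_simp
      rw [← key] at he hu'
      have hpos : 0 < |u - (cfP nthPrime n : ℝ) / cfQ nthPrime n| := pos_of_mul_pos_left he hq.le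
      refine ⟨?_, ?_, ?_⟩
      · have := cfQ_pos nthPrime hp_lower n
        show (1 : ℤ) ≤ (cfQ nthPrime n : ℤ)
        omega
      · simpa using hpos
      · simp only [Int.cast_natCast]
        rw [lt_div_iff₀ (by positivity)]
        nlinarith
end
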